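/- For every n ≥ 2, the derivative map D : RC_n → QC_{n−1}, P ↦ P′, is a surjective locally trivial fibration with fibre the complex plane minus n−1 points. Precisely: for every Q⁰ ∈ QC_{n−1}, let P⁰(X) = ∫₀^X Q⁰(t) dt and let β⁰₁, …, β⁰_{n−1} be the (distinct) roots of Q⁰; then there exist an open neighbourhood V of Q⁰ in QC_{n−1} and a homeomorphism Ψ : V × (ℂ ∖ {P⁰(β⁰₁), …, P⁰(β⁰_{n−1})}) → D⁻¹(V) such that D(Ψ(Q, z)) = Q for all (Q, z). -/

import Mathlib

open Polynomial

/-- The primitive `∫₀^X Q(t) dt` (vanishing at `0`) of a polynomial. -/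
noncomputable def pint (Q : Polynomial ℂ) : Polynomial ℂ :=
  Q.sum fun k a => C (a / (k + 1)) * X ^ (k + 1)

/-- The monic polynomial `X^n + Σᵢ cᵢ Xⁱ` with non-leading coefficient
tuple `c ∈ ℂⁿ`. -/
noncomputable def monicOf (n : ℕ) (c : Fin n → ℂ) : Polynomial ℂ :=
  X ^ n + ∑ i : Fin n, C (c i) * X ^ (i : ℕ)

/-- The polynomial `n·X^{n−1} + Σᵢ qᵢ Xⁱ` of degree `n−1` with leading
coefficient `n` and non-leading coefficient tuple `q ∈ ℂ^{n−1}`. -/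
noncomputable def leadOf (n : ℕ) (q : Fin (n - 1) → ℂ) : Polynomial ℂ :=
  C (n : ℂ) * X ^ (n - 1) + ∑ i : Fin (n - 1), C (q i) * X ^ (i : ℕ)

/-- `QC_{n−1}` in coefficient coordinates: polynomials `Q` of degree `n−1`
with leading coefficient `n`, with `n−1` distinct roots, whose primitive `P`
takes distinct values at distinct roots of `Q`. -/
def QCset (n : ℕ) : Set (Fin (n - 1) → ℂ) :=
  {q | (leadOf n q).roots.toFinset.card = n - 1 ∧
    ∀ x ∈ (leadOf n q).roots, ∀ y ∈ (leadOf n q).roots, x ≠ y →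
      (pint (leadOf n q)).eval x ≠ (pint (leadOf n q)).eval y}

/-- The derivative map in coefficient coordinates: the derivative of
`X^n + Σ cᵢ Xⁱ` is `n·X^{n−1} + Σⱼ (j+1)c_{j+1} Xʲ`. -/
def Dmap (n : ℕ) (c : Fin n → ℂ) : Fin (n - 1) → ℂ :=
  fun j => ((j : ℕ) + 1 : ℂ) * c ⟨(j : ℕ) + 1, by have := j.isLt; omega⟩

/-- `RC_n` in coefficient coordinates: monic polynomials of degree `n` with
`n` distinct roots whose derivative lies in `QC_{n−1}`. -/
def RCset (n : ℕ) : Set (Fin n → ℂ) :=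
  {c | (monicOf n c).roots.toFinset.card = n ∧ Dmap n c ∈ QCset n}

/-- The restriction `D : RC_n → QC_{n−1}` of the derivative map. -/
def Dres (n : ℕ) : ↥(RCset n) → ↥(QCset n) := fun c => ⟨Dmap n c.1, c.2.2⟩

/-- The complex plane minus the `n−1` critical values of the primitive of
`Q⁰`, i.e. `ℂ ∖ {P⁰(β⁰₁), …, P⁰(β⁰_{n−1})}`. -/
def fiberSet (n : ℕ) (q0 : ↥(QCset n)) : Set ℂ :=
  {z | ∀ β : ℂ, (leadOf n q0.1).IsRoot β → z ≠ (pint (leadOf n q0.1)).eval β}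

namespace DerivativeFibration

lemma derivative_pint (Q : ℂ[X]) : derivative (pint Q) = Q := by
  conv_rhs => rw [Q.as_sum_support_C_mul_X_pow]
  rw [pint, Polynomial.sum, derivative_sum]
  refine Finset.sum_congr rfl fun k _ => ?_
  have hk : (k : ℂ) + 1 ≠ 0 := by exact_mod_cast k.succ_ne_zero
  rw [derivative_C_mul_X_pow, Nat.add_sub_cancel]
  push_cast
  rw [div_mul_cancel₀ _ hk]

lemma eval_zero_pint (Q : ℂ[X]) : (pint Q).eval 0 = 0 := by
  simp [pint, Polynomial.sum, eval_finsetSum]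

lemma eq_pint_derivative_add_C (P : ℂ[X]) : P = pint (derivative P) + C (P.eval 0) := by
  have h : derivative (P - pint (derivative P)) = 0 := by
    rw [derivative_sub, derivative_pint, sub_self]
  have h2 := eq_C_of_natDegree_eq_zero (derivative_eq_zero.1 h)
  have h3 := congrArg (eval 0) h2
  rw [eval_sub, eval_zero_pint, sub_zero, eval_C] at h3
  rw [h3, ← h2]
  ring

lemma derivative_monicOf {n : ℕ} (hn : 2 ≤ n) (c : Fin n → ℂ) :
    derivative (monicOf n c) = leadOf n (Dmap n c) := by
  obtain ⟨m, rfl⟩ : ∃ m, n = m + 1 := ⟨n - 1, by omega⟩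
  simp only [monicOf, leadOf, Fin.sum_univ_succ, derivative_add, derivative_sum,
    derivative_C_mul_X_pow, derivative_X_pow, Dmap, Nat.add_sub_cancel]
  simp [mul_comm, Fin.succ]

lemma eval_monicOf (n : ℕ) (c : Fin n → ℂ) (x : ℂ) :
    (monicOf n c).eval x = x ^ n + ∑ i : Fin n, c i * x ^ (i : ℕ) := by
  simp [monicOf, eval_finsetSum]

lemma eval_leadOf (n : ℕ) (q : Fin (n - 1) → ℂ) (x : ℂ) :
    (leadOf n q).eval x = n * x ^ (n - 1) + ∑ i : Fin (n - 1), q i * x ^ (i : ℕ) := by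
  simp [leadOf, eval_finsetSum]

lemma eval_zero_monicOf {n : ℕ} (hn : 2 ≤ n) (c : Fin n → ℂ) :
    (monicOf n c).eval 0 = c ⟨0, by omega⟩ := by
  obtain ⟨m, rfl⟩ : ∃ m, n = m + 1 := ⟨n - 1, by omega⟩
  rw [eval_monicOf, Fin.sum_univ_succ]
  simp

lemma monicOf_eq_pint_add_C {n : ℕ} (hn : 2 ≤ n) (c : Fin n → ℂ) :
    monicOf n c = pint (leadOf n (Dmap n c)) + C (c ⟨0, by omega⟩) := by
  rw [← derivative_monicOf hn, ← eval_zero_monicOf hn c]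
  exact eq_pint_derivative_add_C _

lemma degree_sum_C_mul_X_pow_lt {n : ℕ} (c : Fin n → ℂ) :
    (∑ i : Fin n, C (c i) * X ^ (i : ℕ)).degree < (n : WithBot ℕ) := by
  refine (degree_sum_le _ _).trans_lt ((Finset.sup_lt_iff (WithBot.bot_lt_coe n)).2 fun i _ => ?_)
  exact (degree_C_mul_X_pow_le _ _).trans_lt (WithBot.coe_lt_coe.2 i.2)

lemma degree_monicOf (n : ℕ) (c : Fin n → ℂ) : (monicOf n c).degree = n := by
  rw [monicOf, degree_add_eq_left_of_degree_lt, degree_X_pow]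
  simpa using degree_sum_C_mul_X_pow_lt c

lemma leadOf_degree_and_leadingCoeff {n : ℕ} (hn : 2 ≤ n) (q : Fin (n - 1) → ℂ) :
    (leadOf n q).degree = (n - 1 : ℕ) ∧ (leadOf n q).leadingCoeff = n := by
  have h0 : (n : ℂ) ≠ 0 := by exact_mod_cast (by omega : n ≠ 0)
  have h : (∑ i : Fin (n - 1), C (q i) * X ^ (i : ℕ)).degree <
      (C (n : ℂ) * X ^ (n - 1)).degree := by
    rw [degree_C_mul_X_pow _ h0]
    exact degree_sum_C_mul_X_pow_lt q
  rw [leadOf, degree_add_eq_left_of_degree_lt h, leadingCoeff_add_of_degree_lt' h,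
    degree_C_mul_X_pow _ h0, leadingCoeff_C_mul_X_pow]
  exact ⟨rfl, rfl⟩

lemma leadOf_ne_zero {n : ℕ} (hn : 2 ≤ n) (q : Fin (n - 1) → ℂ) : leadOf n q ≠ 0 := by
  intro h
  have := (leadOf_degree_and_leadingCoeff hn q).1
  simp [h] at this

/-- A nonzero complex polynomial has as many distinct roots as its degree iff it shares no root
with its derivative. -/
lemma card_toFinset_roots_eq_natDegree_iff {P : ℂ[X]} (hP : P ≠ 0) :
    P.roots.toFinset.card = P.natDegree ↔
      ∀ x, (derivative P).IsRoot x → ¬ P.IsRoot x := by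
  rw [← IsAlgClosed.card_roots_eq_natDegree (p := P),
    Multiset.toFinset_card_eq_card_iff_nodup, Multiset.nodup_iff_count_le_one]
  refine forall_congr' fun x => ?_
  rw [count_roots, ← not_lt, one_lt_rootMultiplicity_iff_isRoot hP]
  tauto

/-- Membership in `RC_n` in terms of the derivative and the constant coefficient. -/
lemma mem_RCset_iff {n : ℕ} (hn : 2 ≤ n) (c : Fin n → ℂ) :
    c ∈ RCset n ↔ Dmap n c ∈ QCset n ∧ ∀ β, (leadOf n (Dmap n c)).IsRoot β →
      -c ⟨0, by omega⟩ ≠ (pint (leadOf n (Dmap n c))).eval β := by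
  have hdeg := degree_monicOf n c
  have hne : monicOf n c ≠ 0 := by
    intro h
    simp [h] at hdeg
  have hcard := card_toFinset_roots_eq_natDegree_iff hne
  rw [natDegree_eq_of_degree_eq_some hdeg, derivative_monicOf hn] at hcard
  rw [RCset, Set.mem_ofPred_eq, hcard, and_comm]
  refine and_congr_right fun _ => forall₂_congr fun β _ => ?_
  rw [monicOf_eq_pint_add_C hn c, IsRoot, eval_add, eval_C, Ne, neg_eq_iff_add_eq_zero, add_comm]

/-- The coefficients of the monic polynomial with derivative `leadOf n q` and constant
coefficient `-z`. -/
noncomputable def primitiveCoeffs (n : ℕ) (q : Fin (n - 1) → ℂ) (z : ℂ) : Fin n → ℂ :=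
  fun i => if h : (i : ℕ) = 0 then -z else q ⟨i - 1, by omega⟩ / (i : ℕ)

lemma primitiveCoeffs_zero {n : ℕ} (hn : 2 ≤ n) (q : Fin (n - 1) → ℂ) (z : ℂ) :
    primitiveCoeffs n q z ⟨0, by omega⟩ = -z := by
  simp [primitiveCoeffs]

lemma Dmap_primitiveCoeffs (n : ℕ) (q : Fin (n - 1) → ℂ) (z : ℂ) :
    Dmap n (primitiveCoeffs n q z) = q := by
  funext j
  have hj : (j : ℂ) + 1 ≠ 0 := by exact_mod_cast (j : ℕ).succ_ne_zero
  simp [Dmap, primitiveCoeffs, mul_div_cancel₀ _ hj]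

lemma primitiveCoeffs_Dmap {n : ℕ} (hn : 2 ≤ n) (c : Fin n → ℂ) :
    primitiveCoeffs n (Dmap n c) (-c ⟨0, by omega⟩) = c := by
  funext ⟨i, hi⟩
  rcases i with _ | i
  · simp [primitiveCoeffs]
  · have hj : (i : ℂ) + 1 ≠ 0 := by exact_mod_cast i.succ_ne_zero
    simp [Dmap, primitiveCoeffs, mul_div_cancel_left₀ _ hj]

lemma continuous_Dmap (n : ℕ) : Continuous (Dmap n) := by
  unfold Dmap
  fun_prop

lemma continuous_primitiveCoeffs (n : ℕ) :
    Continuous fun p : (Fin (n - 1) → ℂ) × ℂ => primitiveCoeffs n p.1 p.2 := by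
  refine continuous_pi fun i => ?_
  by_cases h : (i : ℕ) = 0
  · simp only [primitiveCoeffs, h, dite_true]
    fun_prop
  · simp only [primitiveCoeffs, h, dite_false]
    fun_prop

lemma continuous_eval_leadOf (n : ℕ) (x : ℂ) :
    Continuous fun q : Fin (n - 1) → ℂ => (leadOf n q).eval x := by
  simp only [eval_leadOf]
  fun_prop

lemma continuous_eval_pint_leadOf {n : ℕ} (hn : 2 ≤ n) :
    Continuous fun p : (Fin (n - 1) → ℂ) × ℂ => (pint (leadOf n p.1)).eval p.2 := by
  have h : ∀ p : (Fin (n - 1) → ℂ) × ℂ, (pint (leadOf n p.1)).eval p.2 =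
      p.2 ^ n + ∑ i : Fin n, primitiveCoeffs n p.1 0 i * p.2 ^ (i : ℕ) := by
    intro p
    have h := monicOf_eq_pint_add_C hn (primitiveCoeffs n p.1 0)
    rw [Dmap_primitiveCoeffs, primitiveCoeffs_zero hn, neg_zero, C_0, add_zero] at h
    rw [← h, eval_monicOf]
  simp only [h]
  have hc : ∀ i : Fin n, Continuous fun p : (Fin (n - 1) → ℂ) × ℂ => primitiveCoeffs n p.1 0 i :=
    fun i => (continuous_apply i).comp
      ((continuous_primitiveCoeffs n).comp (continuous_fst.prodMk continuous_const))
  fun_prop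

open Filter Topology

lemma pow_card_le_norm_eval_prod {s : Multiset ℂ} {β : ℂ} {ε : ℝ} (hε : 0 ≤ ε)
    (hs : ∀ x ∈ s, ε ≤ dist x β) :
    ε ^ s.card ≤ ‖((s.map fun x => X - C x).prod).eval β‖ := by
  induction s using Multiset.induction with
  | empty => simp
  | cons a s ih =>
    rw [Multiset.forall_mem_cons, dist_comm, dist_eq_norm] at hs
    rw [Multiset.card_cons, Multiset.map_cons, Multiset.prod_cons, eval_mul, norm_mul, pow_succ',
      eval_sub, eval_X, eval_C]
    exact mul_le_mul hs.1 (ih hs.2) (by positivity) (norm_nonneg _)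

/-- Every root of `leadOf n q` is a limit of roots of nearby polynomials. -/
lemma eventually_exists_root_near {n : ℕ} (hn : 2 ≤ n) {q : Fin (n - 1) → ℂ} {β : ℂ}
    (hβ : (leadOf n q).IsRoot β) {ε : ℝ} (hε : 0 < ε) :
    ∀ᶠ q' in 𝓝 q, ∃ x, (leadOf n q').IsRoot x ∧ dist x β < ε := by
  have hn0 : (0 : ℝ) < n := by exact_mod_cast (by omega : 0 < n)
  have hlim : Tendsto (fun q' => ‖(leadOf n q').eval β‖) (𝓝 q) (𝓝 0) := by
    have h := ((continuous_eval_leadOf n β).tendsto q).norm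
    rwa [hβ.eq_zero, norm_zero] at h
  filter_upwards [hlim.eventually_lt_const (by positivity : 0 < n * ε ^ (n - 1))] with q' hq'
  by_contra! hfar
  refine hq'.not_ge ?_
  obtain ⟨hdeg, hlead⟩ := leadOf_degree_and_leadingCoeff hn q'
  have hcard : (leadOf n q').roots.card = n - 1 := by
    rw [IsAlgClosed.card_roots_eq_natDegree, natDegree_eq_of_degree_eq_some hdeg]
  have hsplit := (IsAlgClosed.splits (leadOf n q')).eq_prod_roots
  rw [hsplit, hlead, eval_mul, eval_C, norm_mul, Complex.norm_natCast, ← hcard]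
  gcongr
  exact pow_card_le_norm_eval_prod hε.le fun x hx => hfar x (isRoot_of_mem_roots hx)

lemma exists_pos_le_dist {ι : Type} [Finite ι] {w : ι → ℂ} (hw : Function.Injective w) :
    ∃ r : ℝ, 0 < r ∧ ∀ i j, i ≠ j → r ≤ dist (w i) (w j) := by
  have h : ∀ᶠ r : ℝ in 𝓝[>] 0, ∀ i j, i ≠ j → r ≤ dist (w i) (w j) := by
    refine eventually_all.2 fun i => eventually_all.2 fun j => ?_
    by_cases hij : i = j
    · simp [hij]
    · filter_upwards [Ioc_mem_nhdsGT (dist_pos.2 (hw.ne hij))] with r hr _ using hr.2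
  obtain ⟨r, hr, hr0⟩ := (h.and self_mem_nhdsWithin).exists
  exact ⟨r, hr0, hr⟩

lemma abs_tent_sub_le {r : ℝ} (hr : 0 < r) (z z' w : ℂ) :
    |max 0 (1 - dist z w / r) - max 0 (1 - dist z' w / r)| ≤ dist z z' / r := by
  rw [max_comm 0, max_comm 0]
  refine (abs_max_sub_max_le_abs _ _ _).trans ?_
  rw [sub_sub_sub_cancel_left, ← sub_div, abs_div, abs_of_pos hr, abs_sub_comm]
  gcongr
  exact abs_dist_sub_le z z' w

/-- Finitely many distinct points of the plane can be moved a little by homeomorphisms of the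
plane that depend continuously on the target positions. -/
lemma exists_homeomorph_moving_points {ι : Type} [Fintype ι] {w : ι → ℂ}
    (hw : Function.Injective w) :
    ∃ δ : ℝ, 0 < δ ∧ ∀ (T : Type) [TopologicalSpace T] (u : T → ι → ℂ), Continuous u →
      (∀ t i, dist (u t i) (w i) < δ) →
      ∃ Φ : T × ℂ ≃ₜ T × ℂ, (∀ p, (Φ p).1 = p.1) ∧ ∀ t i, Φ (t, w i) = (t, u t i) := by
  obtain ⟨r, hr, hsep⟩ := exists_pos_le_dist hw
  have hδ : 0 < r / (2 * (Fintype.card ι + 1)) := by positivity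
  refine ⟨r / (2 * (Fintype.card ι + 1)), hδ, fun T _ u hu hδu => ?_⟩
  let g : T → ℂ → ℂ := fun t z => ∑ i, (max 0 (1 - dist z (w i) / r) : ℝ) • (u t i - w i)
  have hg_cont : Continuous fun p : T × ℂ => g p.1 p.2 := by
    have := fun i => (continuous_apply i).comp hu
    simp only [g]
    fun_prop
  have hg_lip : ∀ t z z', dist (g t z) (g t z') ≤ 1 / 2 * dist z z' := by
    intro t z z'
    have hterm : ∀ i, ‖(max 0 (1 - dist z (w i) / r) : ℝ) • (u t i - w i) -
        (max 0 (1 - dist z' (w i) / r) : ℝ) • (u t i - w i)‖ ≤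
        dist z z' / r * (r / (2 * (Fintype.card ι + 1))) := by
      intro i
      rw [← sub_smul, norm_smul, Real.norm_eq_abs, ← dist_eq_norm]
      exact mul_le_mul (abs_tent_sub_le hr z z' (w i)) (hδu t i).le dist_nonneg (by positivity)
    simp only [g]
    rw [dist_eq_norm, ← Finset.sum_sub_distrib]
    refine (norm_sum_le_of_le _ fun i _ => hterm i).trans ?_
    rw [Finset.sum_const, Finset.card_univ, nsmul_eq_mul]
    have hcard : (Fintype.card ι : ℝ) / (Fintype.card ι + 1) ≤ 1 :=
      (div_le_one (by positivity)).2 (by linarith)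
    calc (Fintype.card ι : ℝ) * (dist z z' / r * (r / (2 * (Fintype.card ι + 1))))
        = (Fintype.card ι : ℝ) / (Fintype.card ι + 1) * (1 / 2 * dist z z') := by
          field_simp
      _ ≤ 1 * (1 / 2 * dist z z') := by gcongr
      _ = 1 / 2 * dist z z' := one_mul _
  have hg_contr : ∀ t y, ContractingWith (1 / 2) fun z => y - g t z := by
    intro t y
    refine ⟨by norm_num, LipschitzWith.of_dist_le_mul fun z z' => ?_⟩
    rw [dist_sub_left]
    simpa using hg_lip t z z'
  have hexp : ∀ t z z', dist z z' ≤ 2 * dist (z + g t z) (z' + g t z') := by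
    intro t z z'
    have h1 := hg_lip t z z'
    have h2 : dist z z' ≤ dist (z + g t z) (z' + g t z') + dist (g t z) (g t z') := by
      rw [dist_eq_norm, dist_eq_norm, dist_eq_norm]
      refine le_trans (le_of_eq ?_) (norm_sub_le _ _)
      congr 1
      ring
    linarith
  let inv : T → ℂ → ℂ := fun t y => ContractingWith.fixedPoint _ (hg_contr t y)
  have hinv : ∀ t y, inv t y + g t (inv t y) = y := by
    intro t y
    have h : y - g t (inv t y) = inv t y := (hg_contr t y).fixedPoint_isFixedPt
    linear_combination -h
  have hinv_left : ∀ t z, inv t (z + g t z) = z := by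
    intro t z
    have h := hexp t (inv t (z + g t z)) z
    rw [hinv, dist_self, mul_zero] at h
    exact dist_le_zero.1 h
  have hinv_cont : Continuous fun p : T × ℂ => inv p.1 p.2 := by
    refine continuous_iff_continuousAt.2 fun p => tendsto_iff_dist_tendsto_zero.2 ?_
    have hlim : Tendsto (fun p' : T × ℂ => 2 * dist p'.2 (inv p.1 p.2 + g p'.1 (inv p.1 p.2)))
        (𝓝 p) (𝓝 0) := by
      have hc : Continuous fun p' : T × ℂ =>
          2 * dist p'.2 (inv p.1 p.2 + g p'.1 (inv p.1 p.2)) := by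
        have := hg_cont.comp (continuous_fst.prodMk continuous_const :
          Continuous fun p' : T × ℂ => (p'.1, inv p.1 p.2))
        simp only [Function.comp_def] at this
        fun_prop
      simpa [hinv] using hc.tendsto p
    refine squeeze_zero (fun _ => dist_nonneg) (fun p' => ?_) hlim
    have h := hexp p'.1 (inv p'.1 p'.2) (inv p.1 p.2)
    rwa [hinv] at h
  refine ⟨{ toFun := fun p => (p.1, p.2 + g p.1 p.2)
            invFun := fun p => (p.1, inv p.1 p.2)
            left_inv := fun p => by simp [hinv_left]
            right_inv := fun p => by simp [hinv]
            continuous_toFun := by fun_prop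
            continuous_invFun := by fun_prop }, fun _ => rfl, fun t j => ?_⟩
  have hgj : g t (w j) = u t j - w j := by
    simp only [g]
    rw [Finset.sum_eq_single j]
    · simp
    · intro i _ hij
      have : 1 ≤ dist (w j) (w i) / r := (one_le_div hr).2 (hsep j i hij.symm)
      rw [max_eq_left (by linarith), zero_smul]
    · simp
  simp [hgj]

/-- Near `q0` the roots of `leadOf n q` are continuous functions of `q`, indexed by the roots
of `leadOf n q0`. -/
lemma exists_continuousAt_roots {n : ℕ} (hn : 2 ≤ n) (q0 : QCset n) :
    ∃ (V : Set (QCset n)) (b : QCset n → {β // (leadOf n q0.1).IsRoot β} → ℂ),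
      IsOpen V ∧ q0 ∈ V ∧ (∀ q ∈ V, ContinuousAt b q) ∧ (∀ β, b q0 β = β) ∧
      ∀ q ∈ V, ∀ x, (leadOf n q.1).IsRoot x ↔ ∃ β, b q β = x := by
  classical
  have hmem : ∀ (q : QCset n) x, x ∈ (leadOf n q.1).roots.toFinset ↔ (leadOf n q.1).IsRoot x := by
    intro q x
    rw [Multiset.mem_toFinset, mem_roots (leadOf_ne_zero hn _)]
  let _ : Fintype {β // (leadOf n q0.1).IsRoot β} := Fintype.subtype _ (hmem q0)
  have hcard0 : Fintype.card {β // (leadOf n q0.1).IsRoot β} = n - 1 := by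
    rw [Fintype.subtype_card, q0.2.1]
  obtain ⟨r, hr, hsep⟩ :=
    exists_pos_le_dist (Subtype.val_injective (p := fun β => (leadOf n q0.1).IsRoot β))
  have hev : ∀ᶠ q : QCset n in 𝓝 q0, ∀ β : {β // (leadOf n q0.1).IsRoot β},
      ∃ x, (leadOf n q.1).IsRoot x ∧ dist x β < r / 2 :=
    eventually_all.2 fun β => continuous_subtype_val.continuousAt.eventually
      (eventually_exists_root_near hn β.2 (half_pos hr))
  obtain ⟨V, hV, hVo, hq0⟩ := eventually_nhds_iff.1 hev
  choose! b hb using hV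
  have huniq : ∀ {x : ℂ} {β γ : {β // (leadOf n q0.1).IsRoot β}},
      dist x β < r / 2 → dist x γ < r / 2 → β = γ := by
    intro x β γ h1 h2
    by_contra hne
    have := hsep β γ hne
    have := dist_triangle_left (β : ℂ) γ x
    linarith
  have hroots : ∀ q ∈ V, ∀ x, (leadOf n q.1).IsRoot x ↔ ∃ β, b q β = x := by
    intro q hq x
    have hinj : Function.Injective (b q) := fun β γ h =>
      huniq (hb q hq β).2 (h ▸ (hb q hq γ).2)
    have himage : Finset.univ.image (b q) = (leadOf n q.1).roots.toFinset := by
      refine Finset.eq_of_subset_of_card_le ?_ ?_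
      · intro y hy
        obtain ⟨β, -, rfl⟩ := Finset.mem_image.1 hy
        exact (hmem q _).2 (hb q hq β).1
      · rw [Finset.card_image_of_injective _ hinj, Finset.card_univ, hcard0, q.2.1]
    rw [← hmem, ← himage]
    simp
  have heq : ∀ q ∈ V, ∀ x β, (leadOf n q.1).IsRoot x → dist x β.1 < r / 2 → b q β = x := by
    intro q hq x β hx hxβ
    obtain ⟨γ, rfl⟩ := (hroots q hq x).1 hx
    rw [huniq hxβ (hb q hq γ).2]
  refine ⟨V, b, hVo, hq0, fun q hq => continuousAt_pi.2 fun β => ?_,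
    fun β => heq q0 hq0 β β β.2 (by simpa using half_pos hr), hroots⟩
  refine Metric.tendsto_nhds.2 fun η hη => ?_
  have hgap : 0 < r / 2 - dist (b q β) β := sub_pos.2 (hb q hq β).2
  filter_upwards [hVo.mem_nhds hq, continuous_subtype_val.continuousAt.eventually
    (eventually_exists_root_near hn (hb q hq β).1 (lt_min hη hgap))] with q' hq' hx
  obtain ⟨x, hx, hxd⟩ := hx
  obtain ⟨hxη, hxgap⟩ := lt_min_iff.1 hxd
  rw [heq q' hq' x β hx (by linarith [dist_triangle x (b q β) β])]
  exact hxη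

lemma finite_roots_leadOf {n : ℕ} (hn : 2 ≤ n) (q : Fin (n - 1) → ℂ) :
    {β | (leadOf n q).IsRoot β}.Finite :=
  finite_setOfPred_isRoot (leadOf_ne_zero hn q)

lemma primitiveCoeffs_mem_RCset_iff {n : ℕ} (hn : 2 ≤ n) (q : QCset n) (z : ℂ) :
    primitiveCoeffs n q.1 z ∈ RCset n ↔ z ∈ fiberSet n q := by
  rw [mem_RCset_iff hn, Dmap_primitiveCoeffs, primitiveCoeffs_zero hn, neg_neg]
  exact and_iff_right q.2

lemma Dres_surjective {n : ℕ} (hn : 2 ≤ n) : Function.Surjective (Dres n) := by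
  intro q
  obtain ⟨z, hz⟩ := ((finite_roots_leadOf hn q.1).image
    fun β => (pint (leadOf n q.1)).eval β).exists_notMem
  refine ⟨⟨primitiveCoeffs n q.1 z, (primitiveCoeffs_mem_RCset_iff hn q z).2 ?_⟩,
    Subtype.ext (Dmap_primitiveCoeffs n q.1 z)⟩
  exact fun β hβ h => hz ⟨β, hβ, h.symm⟩

/-- A parametrized family of homeomorphisms of the plane carrying the critical values over `q0`
to those over `q` trivializes the derivative map over `V`. -/
lemma exists_trivialization {n : ℕ} (hn : 2 ≤ n) (q0 : QCset n) (V : Set (QCset n))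
    (Φ : V × ℂ ≃ₜ V × ℂ) (hfst : ∀ p, (Φ p).1 = p.1)
    (hmem : ∀ p, (Φ p).2 ∈ fiberSet n p.1 ↔ p.2 ∈ fiberSet n q0) :
    ∃ Ψ : V × fiberSet n q0 ≃ₜ (Dres n ⁻¹' V),
      ∀ p : V × fiberSet n q0, Dres n (Ψ p).1 = (p.1 : QCset n) := by
  have hsymm_fst : ∀ p, (Φ.symm p).1 = p.1 := fun p => by
    rw [← hfst, Φ.apply_symm_apply]
  have hD : ∀ (q : QCset n) z h, Dres n ⟨primitiveCoeffs n q.1 z, h⟩ = q := fun q z _ =>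
    Subtype.ext (Dmap_primitiveCoeffs n q.1 z)
  have hto : ∀ p : V × fiberSet n q0,
      primitiveCoeffs n p.1.1.1 (Φ (p.1, p.2.1)).2 ∈ RCset n := fun p =>
    (primitiveCoeffs_mem_RCset_iff hn _ _).2 ((hmem (p.1, p.2.1)).2 p.2.2)
  have hinv : ∀ c : Dres n ⁻¹' V,
      (Φ.symm (⟨Dres n c.1, c.2⟩, -c.1.1 ⟨0, by omega⟩)).2 ∈ fiberSet n q0 := by
    intro c
    rw [← hmem, Φ.apply_symm_apply, hsymm_fst]
    exact ((mem_RCset_iff hn _).1 c.1.2).2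
  have hDcont : Continuous (Dres n) :=
    ((continuous_Dmap n).comp continuous_subtype_val).subtype_mk _
  refine ⟨{ toFun := fun p => ⟨⟨primitiveCoeffs n p.1.1.1 (Φ (p.1, p.2.1)).2, hto p⟩, ?_⟩
            invFun := fun c => (⟨Dres n c.1, c.2⟩, ⟨_, hinv c⟩)
            left_inv := fun p => ?_
            right_inv := fun c => ?_
            continuous_toFun := ?_
            continuous_invFun := ?_ }, fun p => hD _ _ _⟩
  · rw [Set.mem_preimage, hD]
    exact p.1.2
  · have hp : Φ (p.1, p.2.1) = (p.1, (Φ (p.1, p.2.1)).2) := Prod.ext (hfst _) rfl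
    refine Prod.ext (Subtype.ext (hD _ _ _)) (Subtype.ext ?_)
    simp only [hD, primitiveCoeffs_zero hn, neg_neg, Subtype.coe_eta]
    rw [← hp, Φ.symm_apply_apply]
  · refine Subtype.ext (Subtype.ext ?_)
    have hc : ((⟨Dres n c.1, c.2⟩ : V), (Φ.symm (⟨Dres n c.1, c.2⟩, -c.1.1 ⟨0, by omega⟩)).2) =
        Φ.symm (⟨Dres n c.1, c.2⟩, -c.1.1 ⟨0, by omega⟩) :=
      Prod.ext (hsymm_fst (⟨Dres n c.1, c.2⟩, -c.1.1 ⟨0, by omega⟩)).symm rfl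
    simp only [hc, Φ.apply_symm_apply]
    exact primitiveCoeffs_Dmap hn c.1.1
  · refine Continuous.subtype_mk (Continuous.subtype_mk ?_ _) _
    refine (continuous_primitiveCoeffs n).comp (Continuous.prodMk ?_ ?_) <;> fun_prop
  · refine Continuous.prodMk (Continuous.subtype_mk ?_ _) (Continuous.subtype_mk ?_ _)
    · fun_prop
    · refine continuous_snd.comp (Φ.symm.continuous.comp (Continuous.prodMk ?_ ?_))
      · exact Continuous.subtype_mk (by fun_prop) _
      · exact ((continuous_apply _).comp
          (continuous_subtype_val.comp continuous_subtype_val)).neg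

lemma exists_locally_trivial {n : ℕ} (hn : 2 ≤ n) (q0 : QCset n) :
    ∃ V : Set (QCset n), IsOpen V ∧ q0 ∈ V ∧
      ∃ Ψ : V × fiberSet n q0 ≃ₜ (Dres n ⁻¹' V),
        ∀ p : V × fiberSet n q0, Dres n (Ψ p).1 = (p.1 : QCset n) := by
  obtain ⟨V, b, hVo, hq0, hbc, hb0, hroots⟩ := exists_continuousAt_roots hn q0
  let _ : Fintype {β // (leadOf n q0.1).IsRoot β} := (finite_roots_leadOf hn q0.1).fintype
  let u : QCset n → {β // (leadOf n q0.1).IsRoot β} → ℂ :=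
    fun q β => (pint (leadOf n q.1)).eval (b q β)
  have hu : ∀ q ∈ V, ContinuousAt u q := fun q hq => continuousAt_pi.2 fun β =>
    (continuous_eval_pint_leadOf hn).continuousAt.comp (f := fun q : QCset n => (q.1, b q β))
      (continuous_subtype_val.continuousAt.prodMk (continuousAt_pi.1 (hbc q hq) β))
  have hw : Function.Injective (u q0) := by
    intro β γ h
    simp only [u, hb0] at h
    by_contra hne
    exact q0.2.2 β ((mem_roots (leadOf_ne_zero hn _)).2 β.2) γ
      ((mem_roots (leadOf_ne_zero hn _)).2 γ.2) (Subtype.coe_ne_coe.2 hne) h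
  obtain ⟨δ, hδ, hmove⟩ := exists_homeomorph_moving_points hw
  have hev : ∀ᶠ q in 𝓝 q0, q ∈ V ∧ ∀ β, dist (u q β) (u q0 β) < δ :=
    (hVo.eventually_mem hq0).and (eventually_all.2 fun β =>
      Metric.tendsto_nhds.1 (continuousAt_pi.1 (hu q0 hq0) β) δ hδ)
  obtain ⟨W, hW, hWo, hq0W⟩ := eventually_nhds_iff.1 hev
  obtain ⟨Φ, hfst, hΦ⟩ := hmove W (fun q => u q.1)
    (continuous_iff_continuousAt.2 fun q =>
      (hu q.1 (hW q.1 q.2).1).comp continuous_subtype_val.continuousAt)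
    (fun q => (hW q.1 q.2).2)
  refine ⟨W, hWo, hq0W, exists_trivialization hn q0 W Φ hfst fun ⟨q, z⟩ => ?_⟩
  have hfiber : ∀ q ∈ V, ∀ z, z ∈ fiberSet n q ↔ ∀ β, z ≠ u q β := by
    intro q hq z
    simp only [fiberSet, Set.mem_ofPred_eq, hroots q hq, u]
    exact ⟨fun h β => h _ ⟨β, rfl⟩, by rintro h _ ⟨β, rfl⟩; exact h β⟩
  rw [hfiber q.1 (hW q.1 q.2).1, hfiber q0 hq0]
  refine forall_congr' fun β => not_congr ?_
  rw [← (Prod.mk_right_injective q).eq_iff (a := z), ← Φ.injective.eq_iff, hΦ,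
    Prod.ext_iff, hfst, and_iff_right rfl]

end DerivativeFibration


/-- for `n ≥ 2` the derivative map `D : RC_n → QC_{n−1}` is a
surjective locally trivial fibration with fibre the plane minus `n−1` points:
`D` is continuous and surjective, and every `Q⁰ ∈ QC_{n−1}` has an open
neighbourhood `V` together with a homeomorphism
`Ψ : V × (ℂ ∖ {P⁰(β⁰₁), …, P⁰(β⁰_{n−1})}) ≃ₜ D⁻¹(V)` satisfying
`D(Ψ(Q, z)) = Q`. -/
theorem stmt_0 (n : ℕ) (hn : 2 ≤ n) :
    Continuous (Dres n) ∧ Function.Surjective (Dres n) ∧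
    ∀ q0 : ↥(QCset n), ∃ V : Set ↥(QCset n), IsOpen V ∧ q0 ∈ V ∧
      ∃ Ψ : ↥V × ↥(fiberSet n q0) ≃ₜ ↥(Dres n ⁻¹' V),
        ∀ p : ↥V × ↥(fiberSet n q0), Dres n (Ψ p).1 = (p.1 : ↥(QCset n)) := by
  exact ⟨((DerivativeFibration.continuous_Dmap n).comp continuous_subtype_val).subtype_mk _,
    DerivativeFibration.Dres_surjective hn, DerivativeFibration.exists_locally_trivial hn⟩
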